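/- arXiv:0907.1129 — 11 statements merged into one kernel-verified Lean document; each statement's English description precedes it below -/
import Mathlib

section
/- Let λ : A → A be a unital *-homomorphism. Define U := Σ_{i=1}^m λ(s_{e_i}) s_{e_i}^*, V := Σ_{j=1}^n λ(s_{f_j}) s_{f_j}^*, and W := Σ_{i=1}^m Σ_{j=1}^n λ(s_{e_i} s_{f_j}) (s_{e_i} s_{f_j})^*. Then U, V, W are unitaries of A, λ(s_{e_i}) = U s_{e_i} and λ(s_{f_j}) = V s_{f_j} for all i, j, and U λ_{ε1}(V) = W = V λ_{ε2}(U); in particular (U, V) is a twisted pair. -/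
open scoped ComplexOrder

noncomputable section

variable {A : Type*} [CStarAlgebra A]

/-- The map `λ_ε` associated to a family `s`: `X ↦ ∑ i, s i * X * (s i)^*`.
With `s = s_e` this is `λ_{ε₁}`; with `s = s_f` this is `λ_{ε₂}`. -/
def lamE {m : ℕ} (s : Fin m → A) (X : A) : A := ∑ i, s i * X * star (s i)

/-- The word `s_{a,b} = s_{e_{a_1}}⋯s_{e_{a_k}} s_{f_{b_1}}⋯s_{f_{b_l}}` of degree `(k,l)`. -/
def sWord {m n : ℕ} (se : Fin m → A) (sf : Fin n → A)
    {k l : ℕ} (a : Fin k → Fin m) (b : Fin l → Fin n) : A :=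
  (List.ofFn fun t => se (a t)).prod * (List.ofFn fun t => sf (b t)).prod

/-- The UHF core `𝔉`: closed linear span of `s_{a,b} s_{a',b'}^*` over pairs of words of
equal degree. -/
def FF {m n : ℕ} (se : Fin m → A) (sf : Fin n → A) : Submodule ℂ A :=
  (Submodule.span ℂ {x : A | ∃ (k l : ℕ) (a a' : Fin k → Fin m) (b b' : Fin l → Fin n),
    x = sWord se sf a b * star (sWord se sf a' b')}).topologicalClosure

/-- The canonical masa `𝔇`: closed linear span of `s_{a,b} s_{a,b}^*`. -/
def DD {m n : ℕ} (se : Fin m → A) (sf : Fin n → A) : Submodule ℂ A :=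
  (Submodule.span ℂ {x : A | ∃ (k l : ℕ) (a : Fin k → Fin m) (b : Fin l → Fin n),
    x = sWord se sf a b * star (sWord se sf a b)}).topologicalClosure

section CuntzFamily

variable {ι κ : Type*}

theorem star_mul_pairwise [DecidableEq ι] [DecidableEq κ] {s : ι → A} {t : κ → A}
    (hs : ∀ i k, star (s i) * s k = if i = k then (1 : A) else 0)
    (ht : ∀ j l, star (t j) * t l = if j = l then (1 : A) else 0) (p q : ι × κ) :
    star (s p.1 * t p.2) * (s q.1 * t q.2) = if p = q then (1 : A) else 0 := by
  calc star (s p.1 * t p.2) * (s q.1 * t q.2)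
      = star (t p.2) * (star (s p.1) * s q.1) * t q.2 := by simp only [star_mul, mul_assoc]
    _ = if p = q then (1 : A) else 0 := by
      rw [hs]
      by_cases h : p.1 = q.1 <;> simp [h, ht, Prod.ext_iff]

variable [Fintype ι] [Fintype κ]

/-- The element `∑ i, lam (s i) * (s i)^*` comparing a family `s` with its image under `lam`. -/
def comparison (lam : A →⋆ₐ[ℂ] A) (s : ι → A) : A := ∑ i, lam (s i) * star (s i)

theorem comparison_mul [DecidableEq ι] {s : ι → A}
    (hs : ∀ i k, star (s i) * s k = if i = k then (1 : A) else 0)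
    (lam : A →⋆ₐ[ℂ] A) (k : ι) : comparison lam s * s k = lam (s k) := by
  simp [comparison, Finset.sum_mul, mul_assoc, hs]

theorem comparison_mem_unitary [DecidableEq ι] {s : ι → A}
    (hs : ∀ i k, star (s i) * s k = if i = k then (1 : A) else 0)
    (hsum : ∑ i, s i * star (s i) = 1) (lam : A →⋆ₐ[ℂ] A) :
    comparison lam s ∈ unitary A := by
  have hstar : star (comparison lam s) = ∑ i, s i * star (lam (s i)) := by
    simp [comparison]
  rw [Unitary.mem_iff]
  constructor
  · calc star (comparison lam s) * comparison lam s
        = ∑ i, ∑ k, s i * lam (star (s i) * s k) * star (s k) := by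
          rw [hstar, comparison, Finset.sum_mul_sum]
          simp only [map_mul, map_star, mul_assoc]
      _ = 1 := by simp [hs, apply_ite lam, hsum]
  · calc comparison lam s * star (comparison lam s)
        = ∑ i, comparison lam s * s i * star (lam (s i)) := by
          rw [hstar, Finset.mul_sum]
          simp only [mul_assoc]
      _ = lam (∑ i, s i * star (s i)) := by
          simp only [comparison_mul hs, map_sum, map_mul, map_star]
      _ = 1 := by rw [hsum, map_one]

theorem sum_mul_star_pairwise {s : ι → A} {t : κ → A}
    (hs : ∑ i, s i * star (s i) = 1) (ht : ∑ j, t j * star (t j) = 1) :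
    ∑ p : ι × κ, s p.1 * t p.2 * star (s p.1 * t p.2) = 1 := by
  calc ∑ p : ι × κ, s p.1 * t p.2 * star (s p.1 * t p.2)
      = ∑ i, s i * (∑ j, t j * star (t j)) * star (s i) := by
        simp only [Fintype.sum_prod_type, Finset.mul_sum, Finset.sum_mul, star_mul, mul_assoc]
    _ = 1 := by simp [ht, hs]

theorem comparison_mul_lamE {m : ℕ} {s : Fin m → A} (t : κ → A)
    (hs : ∀ i k, star (s i) * s k = if i = k then (1 : A) else 0) (lam : A →⋆ₐ[ℂ] A) :
    comparison lam s * lamE s (comparison lam t) =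
      comparison lam fun p : Fin m × κ => s p.1 * t p.2 := by
  calc comparison lam s * lamE s (comparison lam t)
      = ∑ i, comparison lam s * s i * comparison lam t * star (s i) := by
        simp only [lamE, Finset.mul_sum, mul_assoc]
    _ = _ := by
        simp only [comparison_mul hs]
        simp only [comparison, Fintype.sum_prod_type, Finset.mul_sum, Finset.sum_mul, star_mul,
          map_mul, mul_assoc]

theorem comparison_comp_equiv (lam : A →⋆ₐ[ℂ] A) (s : κ → A) (e : ι ≃ κ) :
    comparison lam (fun i => s (e i)) = comparison lam s :=
  Equiv.sum_comp e fun k => lam (s k) * star (s k)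

end CuntzFamily

/-- one direction of Theorem 3.2: from a unital *-homomorphism one extracts
a twisted pair of unitaries. -/
theorem stmt0 {m n : ℕ} (hm : 1 ≤ m) (hn : 1 ≤ n) (θ : Equiv.Perm (Fin m × Fin n))
    (se : Fin m → A) (sf : Fin n → A)
    (he : ∀ i k, star (se i) * se k = if i = k then (1:A) else 0)
    (hf : ∀ j l, star (sf j) * sf l = if j = l then (1:A) else 0)
    (hcomm : ∀ i j, se i * sf j = sf (θ (i, j)).2 * se (θ (i, j)).1)
    (hde : ∑ i, se i * star (se i) = 1)
    (hdf : ∑ j, sf j * star (sf j) = 1)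
    (lam : A →⋆ₐ[ℂ] A) (U V W : A)
    (hU : U = ∑ i, lam (se i) * star (se i))
    (hV : V = ∑ j, lam (sf j) * star (sf j))
    (hW : W = ∑ i, ∑ j, lam (se i * sf j) * star (se i * sf j)) :
    U ∈ unitary A ∧ V ∈ unitary A ∧ W ∈ unitary A ∧
    (∀ i, lam (se i) = U * se i) ∧ (∀ j, lam (sf j) = V * sf j) ∧
    U * lamE se V = W ∧ V * lamE sf U = W := by
  have hW' : W = comparison lam fun p : Fin m × Fin n => se p.1 * sf p.2 := by
    rw [hW, comparison, Fintype.sum_prod_type]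
  have hswap : (fun p : Fin m × Fin n => se p.1 * sf p.2) =
      fun p => sf ((θ.trans (Equiv.prodComm _ _)) p).1 *
        se ((θ.trans (Equiv.prodComm _ _)) p).2 :=
    funext fun p => hcomm p.1 p.2
  change U = comparison lam se at hU
  change V = comparison lam sf at hV
  refine ⟨hU ▸ comparison_mem_unitary he hde lam, hV ▸ comparison_mem_unitary hf hdf lam,
    hW' ▸ comparison_mem_unitary (star_mul_pairwise he hf) (sum_mul_star_pairwise hde hdf) lam,
    fun i => ?_, fun j => ?_, ?_, ?_⟩
  · rw [hU, comparison_mul he]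
  · rw [hV, comparison_mul hf]
  · rw [hU, hV, hW', comparison_mul_lamE sf he]
  · rw [hU, hV, hW', comparison_mul_lamE se hf, hswap]
    exact (comparison_comp_equiv lam (fun q : Fin n × Fin m => sf q.1 * se q.2)
      (θ.trans (Equiv.prodComm _ _))).symm
end
end

section
/- Let (U, V) be a twisted pair of unitaries of A and set W := U λ_{ε1}(V) (= V λ_{ε2}(U)). Then for all i, j one has U s_{e_i} V = W s_{e_i}, V s_{f_j} U = W s_{f_j}, hence U s_{e_i} V s_{f_j} = W s_{e_i} s_{f_j} and V s_{f_{j'}} U s_{e_{i'}} = W s_{f_{j'}} s_{e_{i'}}. Consequently, whenever θ(i,j) = (i',j') one has (U s_{e_i})(V s_{f_j}) = (V s_{f_{j'}})(U s_{e_{i'}}); that is, the assignment s_{e_i} ↦ U s_{e_i}, s_{f_j} ↦ V s_{f_j} preserves the 2-graph commutation relations. -/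
open scoped ComplexOrder

noncomputable section

variable {A : Type*} [CStarAlgebra A]

/-- The map `λ` of a Cuntz family intertwines `X` with each isometry of the family. -/
theorem lamE_mul_apply {m : ℕ} (s : Fin m → A)
    (hs : ∀ i k, star (s i) * s k = if i = k then (1:A) else 0) (X : A) (i : Fin m) :
    lamE s X * s i = s i * X := by
  simp [lamE, Finset.sum_mul, mul_assoc, hs]

/-- key computation in the existence direction of Theorem 3.2: a twisted
pair of unitaries preserves the 2-graph commutation relations. -/
theorem stmt1 {m n : ℕ} (hm : 1 ≤ m) (hn : 1 ≤ n) (θ : Equiv.Perm (Fin m × Fin n))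
    (se : Fin m → A) (sf : Fin n → A)
    (he : ∀ i k, star (se i) * se k = if i = k then (1:A) else 0)
    (hf : ∀ j l, star (sf j) * sf l = if j = l then (1:A) else 0)
    (hcomm : ∀ i j, se i * sf j = sf (θ (i, j)).2 * se (θ (i, j)).1)
    (hde : ∑ i, se i * star (se i) = 1)
    (hdf : ∑ j, sf j * star (sf j) = 1)
    (U V W : A) (hU : U ∈ unitary A) (hV : V ∈ unitary A)
    (htw : U * lamE se V = V * lamE sf U)
    (hW : W = U * lamE se V) :
    (∀ i, U * se i * V = W * se i) ∧
    (∀ j, V * sf j * U = W * sf j) ∧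
    (∀ i j, U * se i * (V * sf j) = W * (se i * sf j)) ∧
    (∀ i' j', V * sf j' * (U * se i') = W * (sf j' * se i')) ∧
    (∀ i j, (U * se i) * (V * sf j) = (V * sf (θ (i, j)).2) * (U * se (θ (i, j)).1)) := by
  have h₁ (i) : U * se i * V = W * se i := by
    rw [hW, mul_assoc, mul_assoc, lamE_mul_apply se he]
  have h₂ (j) : V * sf j * U = W * sf j := by
    rw [hW, htw, mul_assoc, mul_assoc, lamE_mul_apply sf hf]
  have h₃ (i j) : U * se i * (V * sf j) = W * (se i * sf j) := by
    rw [← mul_assoc, h₁, mul_assoc]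
  have h₄ (i j) : V * sf j * (U * se i) = W * (sf j * se i) := by
    rw [← mul_assoc, h₂, mul_assoc]
  exact ⟨h₁, h₂, h₃, h₄, fun i j => by rw [h₃, h₄, hcomm]⟩
end
end

section
/- Assume A is generated by the s's and A is simple (its only closed two-sided ideals are 0 and A). Let λ : A → A be a unital *-homomorphism and U, V unitaries of A with λ(s_{e_i}) = U s_{e_i} and λ(s_{f_j}) = V s_{f_j} for all i, j. If there exist unitaries U_0, V_0 ∈ A such that λ(U_0) = U^* and λ(V_0) = V^*, then λ is bijective, i.e. λ is a *-automorphism of A. -/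
open scoped ComplexOrder

noncomputable section

variable {A : Type*} [CStarAlgebra A]

/-- Lemma 3.6(ii): if the inverses of the determining unitaries are in the
range of the endomorphism, then it is an automorphism (assuming simplicity). -/
theorem stmt3 {m n : ℕ} (hm : 1 ≤ m) (hn : 1 ≤ n) (θ : Equiv.Perm (Fin m × Fin n))
    (se : Fin m → A) (sf : Fin n → A)
    (he : ∀ i k, star (se i) * se k = if i = k then (1:A) else 0)
    (hf : ∀ j l, star (sf j) * sf l = if j = l then (1:A) else 0)
    (hcomm : ∀ i j, se i * sf j = sf (θ (i, j)).2 * se (θ (i, j)).1)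
    (hde : ∑ i, se i * star (se i) = 1)
    (hdf : ∑ j, sf j * star (sf j) = 1)
    (hgen : (StarAlgebra.adjoin ℂ (Set.range se ∪ Set.range sf)).topologicalClosure = ⊤)
    (hsimple : ∀ I : TwoSidedIdeal A, IsClosed (I : Set A) → I = ⊥ ∨ I = ⊤)
    (lam : A →⋆ₐ[ℂ] A) (U V : A) (hU : U ∈ unitary A) (hV : V ∈ unitary A)
    (hle : ∀ i, lam (se i) = U * se i) (hlf : ∀ j, lam (sf j) = V * sf j)
    (U0 V0 : A) (hU0 : U0 ∈ unitary A) (hV0 : V0 ∈ unitary A)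
    (hU0' : lam U0 = star U) (hV0' : lam V0 = star V) :
    Function.Bijective lam := by
  have hinj : Function.Injective lam := by
    have hker : IsClosed (TwoSidedIdeal.ker lam : Set A) := by
      have hset : (TwoSidedIdeal.ker lam : Set A) = lam ⁻¹' {0} := by
        ext x
        simp [TwoSidedIdeal.mem_ker]
      rw [hset]
      have : ContinuousLinearMapClass (A →⋆ₐ[ℂ] A) ℂ A A :=
        NonUnitalStarAlgHom.instContinuousLinearMapClassComplex
      exact isClosed_singleton.preimage (map_continuous lam)
    rcases hsimple _ hker with h | h
    · exact (TwoSidedIdeal.ker_eq_bot lam).1 h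
    · have h1 : (1 : A) ∈ TwoSidedIdeal.ker lam := h ▸ trivial
      rw [TwoSidedIdeal.mem_ker, map_one] at h1
      have : Subsingleton A := subsingleton_of_zero_eq_one h1.symm
      exact Function.injective_of_subsingleton _
  refine ⟨hinj, fun y => ?_⟩
  have hclosed : IsClosed (lam.range : Set A) := by
    change IsClosed (Set.range lam)
    exact (NonUnitalStarAlgHom.isometry lam hinj).isClosedEmbedding.isClosed_range
  have hadj : StarAlgebra.adjoin ℂ (Set.range se ∪ Set.range sf) ≤ lam.range := by
    refine StarAlgebra.adjoin_le ?_
    rintro _ (⟨i, rfl⟩ | ⟨j, rfl⟩)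
    · exact ⟨U0 * se i, by
        change lam _ = _
        rw [map_mul, hU0', hle, ← mul_assoc, Unitary.star_mul_self_of_mem hU, one_mul]⟩
    · exact ⟨V0 * sf j, by
        change lam _ = _
        rw [map_mul, hV0', hlf, ← mul_assoc, Unitary.star_mul_self_of_mem hV, one_mul]⟩
  have hy : y ∈ (StarAlgebra.adjoin ℂ (Set.range se ∪ Set.range sf)).topologicalClosure :=
    hgen ▸ trivial
  exact StarSubalgebra.topologicalClosure_minimal hadj hclosed hy
end
end

section
/- Assume A is generated by the s's. Let λ : A → A be a unital *-homomorphism and U, V unitaries of A with λ(s_{e_i}) = U s_{e_i} and λ(s_{f_j}) = V s_{f_j} for all i, j. Then the following are equivalent: (1) λ is inner, i.e. there is a unitary W ∈ A with λ(x) = W x W^* for all x ∈ A; (2) there is a unitary W ∈ A with U = W λ_{ε1}(W^*) and V = W λ_{ε2}(W^*). -/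
open scoped ComplexOrder

noncomputable section

variable {A : Type*} [CStarAlgebra A]

/-- If the isometries `s i` have range projections summing to `1`, then a `u` with
`u * s i = w * s i * star w` for all `i` is equal to `w * lamE s (star w)`. -/
theorem eq_mul_lamE_of_forall {m : ℕ} {s : Fin m → A} (hs : ∑ i, s i * star (s i) = 1)
    {u w : A} (h : ∀ i, u * s i = w * s i * star w) : u = w * lamE s (star w) := by
  calc u = u * ∑ i, s i * star (s i) := by rw [hs, mul_one]
    _ = w * lamE s (star w) := by
      simp only [lamE, Finset.mul_sum, ← mul_assoc, h]

/-- For isometries with orthogonal ranges, `lamE s x` intertwines: `lamE s x * s k = s k * x`. -/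
theorem lamE_mul {m : ℕ} {s : Fin m → A}
    (hs : ∀ i k, star (s i) * s k = if i = k then (1 : A) else 0) (x : A) (k : Fin m) :
    lamE s x * s k = s k * x := by
  simp [lamE, Finset.sum_mul, mul_assoc, hs]

open scoped CStarAlgebra in
/-- Star algebra homomorphisms of C⋆-algebras agreeing on a set of topological generators
are equal. -/
theorem starAlgHom_ext_of_topologicalClosure_adjoin {S : Set A}
    (hS : (StarAlgebra.adjoin ℂ S).topologicalClosure = ⊤) {f g : A →⋆ₐ[ℂ] A}
    (h : Set.EqOn f g S) : f = g := by
  have hle : (StarAlgebra.adjoin ℂ S).topologicalClosure ≤ StarAlgHom.equalizer f g :=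
    StarSubalgebra.topologicalClosure_minimal (StarAlgHom.adjoin_le_equalizer f g h)
      (isClosed_eq (map_continuous f) (map_continuous g))
  ext x
  exact hle (hS ▸ StarSubalgebra.mem_top)

/-- Lemma 3.6(iii): the endomorphism determined by `(U, V)` is inner iff
`U = W λ_{ε₁}(W^*)` and `V = W λ_{ε₂}(W^*)` for some unitary `W`. -/
theorem stmt4 {m n : ℕ} (hm : 1 ≤ m) (hn : 1 ≤ n) (θ : Equiv.Perm (Fin m × Fin n))
    (se : Fin m → A) (sf : Fin n → A)
    (he : ∀ i k, star (se i) * se k = if i = k then (1:A) else 0)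
    (hf : ∀ j l, star (sf j) * sf l = if j = l then (1:A) else 0)
    (hcomm : ∀ i j, se i * sf j = sf (θ (i, j)).2 * se (θ (i, j)).1)
    (hde : ∑ i, se i * star (se i) = 1)
    (hdf : ∑ j, sf j * star (sf j) = 1)
    (hgen : (StarAlgebra.adjoin ℂ (Set.range se ∪ Set.range sf)).topologicalClosure = ⊤)
    (lam : A →⋆ₐ[ℂ] A) (U V : A) (hU : U ∈ unitary A) (hV : V ∈ unitary A)
    (hle : ∀ i, lam (se i) = U * se i) (hlf : ∀ j, lam (sf j) = V * sf j) :
    (∃ W ∈ unitary A, ∀ x : A, lam x = W * x * star W) ↔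
    (∃ W ∈ unitary A, U = W * lamE se (star W) ∧ V = W * lamE sf (star W)) := by
  constructor
  · rintro ⟨W, hW, h⟩
    exact ⟨W, hW, eq_mul_lamE_of_forall hde fun i => by rw [← hle, h],
      eq_mul_lamE_of_forall hdf fun j => by rw [← hlf, h]⟩
  · rintro ⟨W, hW, rfl, rfl⟩
    have key : lam = (Unitary.conjStarAlgAut ℂ A ⟨W, hW⟩ : A →⋆ₐ[ℂ] A) := by
      apply starAlgHom_ext_of_topologicalClosure_adjoin hgen
      rintro _ (⟨i, rfl⟩ | ⟨j, rfl⟩)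
      · simp [hle, mul_assoc, lamE_mul he]
      · simp [hlf, mul_assoc, lamE_mul hf]
    refine ⟨W, hW, fun x => ?_⟩
    simp [key]
end
end

section
/- Assume A is generated by the s's. Let W ∈ A be a unitary such that W λ_{ε1}(W^*) = 1 and W λ_{ε2}(W^*) = 1. Then W commutes with every s_{e_i} and every s_{f_j}, and hence W lies in the center of A. -/
open scoped ComplexOrder

noncomputable section

variable {A : Type*} [CStarAlgebra A]

/-- If the `s i` are isometries with orthogonal ranges, a fixed point of `λ` commutes with each
`s k`. -/
theorem commute_of_lamE_eq {m : ℕ} {s : Fin m → A}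
    (hs : ∀ i k, star (s i) * s k = if i = k then (1 : A) else 0)
    {X : A} (hX : lamE s X = X) (k : Fin m) : Commute X (s k) := by
  have h : lamE s X * s k = s k * X := by
    simp [lamE, Finset.sum_mul, mul_assoc, hs]
  rwa [hX] at h

/-- If `W` is unitary and `W * λ (star W) = 1`, then `star W` is a fixed point of `λ`. -/
theorem lamE_star_eq {m : ℕ} {s : Fin m → A} {W : A} (hW : W ∈ unitary A)
    (h : W * lamE s (star W) = 1) : lamE s (star W) = star W := by
  rw [← one_mul (lamE s (star W)), ← Unitary.star_mul_self_of_mem hW, mul_assoc, h, mul_one]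

/-- A unitary commutes with whatever its adjoint commutes with. -/
theorem commute_of_commute_star {W x : A} (hW : W ∈ unitary A) (h : Commute (star W) x) :
    Commute W x := by
  calc W * x = W * (x * star W) * W := by
        rw [mul_assoc, mul_assoc, Unitary.star_mul_self_of_mem hW, mul_one]
    _ = x * W := by
        rw [← h.eq, ← mul_assoc, Unitary.mul_star_self_of_mem hW, one_mul]

/-- An element commuting, together with its adjoint, with a set generating a dense star subalgebra
is central. -/
theorem commute_of_topologicalClosure_adjoin_eq_top {S : Set A}
    (hS : (StarAlgebra.adjoin ℂ S).topologicalClosure = ⊤) {W : A}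
    (h : ∀ s ∈ S, Commute W s) (h' : ∀ s ∈ S, Commute (star W) s) (x : A) : Commute W x := by
  have hle : StarAlgebra.adjoin ℂ S ≤ StarSubalgebra.centralizer ℂ {W} :=
    StarAlgebra.adjoin_le fun s hs => by
      rw [SetLike.mem_coe, StarSubalgebra.mem_centralizer_iff]
      rintro _ rfl
      exact ⟨h s hs, h' s hs⟩
  have hclosed : IsClosed (StarSubalgebra.centralizer ℂ {W} : Set A) := by
    rw [StarSubalgebra.coe_centralizer]
    exact Set.isClosed_centralizer _
  have hx : x ∈ StarSubalgebra.centralizer ℂ {W} :=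
    StarSubalgebra.topologicalClosure_minimal hle hclosed (hS ▸ trivial)
  exact ((StarSubalgebra.mem_centralizer_iff ℂ).1 hx W rfl).1

/-- Lemma 3.6(iii), kernel statement: a unitary `W` with
`W λ_{ε₁}(W^*) = 1 = W λ_{ε₂}(W^*)` commutes with all generators, hence is central. -/
theorem stmt5 {m n : ℕ} (hm : 1 ≤ m) (hn : 1 ≤ n) (θ : Equiv.Perm (Fin m × Fin n))
    (se : Fin m → A) (sf : Fin n → A)
    (he : ∀ i k, star (se i) * se k = if i = k then (1:A) else 0)
    (hf : ∀ j l, star (sf j) * sf l = if j = l then (1:A) else 0)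
    (hcomm : ∀ i j, se i * sf j = sf (θ (i, j)).2 * se (θ (i, j)).1)
    (hde : ∑ i, se i * star (se i) = 1)
    (hdf : ∑ j, sf j * star (sf j) = 1)
    (hgen : (StarAlgebra.adjoin ℂ (Set.range se ∪ Set.range sf)).topologicalClosure = ⊤)
    (W : A) (hW : W ∈ unitary A)
    (h1 : W * lamE se (star W) = 1) (h2 : W * lamE sf (star W) = 1) :
    (∀ i, W * se i = se i * W) ∧ (∀ j, W * sf j = sf j * W) ∧ (∀ x : A, W * x = x * W) := by
  have he' := commute_of_lamE_eq he (lamE_star_eq hW h1)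
  have hf' := commute_of_lamE_eq hf (lamE_star_eq hW h2)
  have hstar : ∀ s ∈ Set.range se ∪ Set.range sf, Commute (star W) s := by
    rintro _ (⟨i, rfl⟩ | ⟨j, rfl⟩)
    exacts [he' i, hf' j]
  exact ⟨fun i => commute_of_commute_star hW (he' i), fun j => commute_of_commute_star hW (hf' j),
    fun x => commute_of_topologicalClosure_adjoin_eq_top hgen
      (fun s hs => commute_of_commute_star hW (hstar s hs)) hstar x⟩
end
end

section
/- Let λ : A → A be a unital *-homomorphism and U, V unitaries of A with λ(s_{e_i}) = U s_{e_i} and λ(s_{f_j}) = V s_{f_j} for all i, j, and set W := U λ_{ε1}(V). Define λ_{(1,1)}(Y) := Σ_{i,j} (s_{e_i} s_{f_j}) Y (s_{e_i} s_{f_j})^*. Then for every k ≥ 1 and all products u = u_1⋯u_k, v = v_1⋯v_k in which each u_t and each v_t is a degree-(1,1) word of the form s_{e_i} s_{f_j}, one has λ(s_u s_v^*) = P_k (s_u s_v^*) P_k^*, where s_u := u_1⋯u_k, s_v := v_1⋯v_k and P_k := W · λ_{(1,1)}(W) · λ_{(1,1)}^2(W) ⋯ λ_{(1,1)}^{k-1}(W).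 -/
open scoped ComplexOrder

noncomputable section

variable {A : Type*} [CStarAlgebra A]

/-- `λ_{(1,1)}(Y) = ∑_{i,j} (s_{e_i} s_{f_j}) Y (s_{e_i} s_{f_j})^*`. -/
def lam11 {m n : ℕ} (se : Fin m → A) (sf : Fin n → A) (Y : A) : A :=
  ∑ i, ∑ j, (se i * sf j) * Y * star (se i * sf j)

theorem lamE_mul_self {m : ℕ} {s : Fin m → A}
    (hs : ∀ i k, star (s i) * s k = if i = k then (1 : A) else 0) (X : A) (i : Fin m) :
    lamE s X * s i = s i * X := by
  simp [lamE, Finset.sum_mul, mul_assoc, hs]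

theorem lam11_mul_letter {m n : ℕ} {se : Fin m → A} {sf : Fin n → A}
    (he : ∀ i k, star (se i) * se k = if i = k then (1 : A) else 0)
    (hf : ∀ j l, star (sf j) * sf l = if j = l then (1 : A) else 0)
    (Y : A) (i : Fin m) (j : Fin n) :
    lam11 se sf Y * (se i * sf j) = se i * sf j * Y := by
  have h : lam11 se sf Y = lamE se (lamE sf Y) := by
    simp [lam11, lamE, Finset.mul_sum, Finset.sum_mul, mul_assoc]
  rw [h, ← mul_assoc, lamE_mul_self he, mul_assoc, lamE_mul_self hf, mul_assoc]

theorem iterate_mul_prod_ofFn {M ι : Type*} [Monoid M] {φ : M → M} {x : ι → M}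
    (hφ : ∀ Y i, φ Y * x i = x i * Y) (Y : M) {k : ℕ} (u : Fin k → ι) :
    φ^[k] Y * (List.ofFn fun t => x (u t)).prod = (List.ofFn fun t => x (u t)).prod * Y := by
  induction k with
  | zero => simp
  | succ k ih =>
    rw [Function.iterate_succ_apply', List.ofFn_succ, List.prod_cons, ← mul_assoc, hφ,
      mul_assoc, ih fun t => u t.succ, mul_assoc]

theorem map_prod_ofFn_eq_iterate_prod_mul {M ι F : Type*} [Monoid M] [FunLike F M M]
    [MonoidHomClass F M M] {φ : M → M} {x : ι → M}
    (hφ : ∀ Y i, φ Y * x i = x i * Y) (f : F) (W : M) (hf : ∀ i, f (x i) = W * x i)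
    {k : ℕ} (u : Fin k → ι) :
    f (List.ofFn fun t => x (u t)).prod =
      (List.ofFn fun t : Fin k => φ^[(t : ℕ)] W).prod * (List.ofFn fun t => x (u t)).prod := by
  induction k with
  | zero => simp
  | succ k ih =>
    simp only [List.ofFn_succ', List.concat_eq_append, List.prod_append, List.prod_singleton,
      map_mul, hf, Fin.val_last, Fin.val_castSucc]
    rw [ih fun t => u t.castSucc]
    simp only [mul_assoc]
    rw [← mul_assoc (φ^[k] W), iterate_mul_prod_ofFn hφ W fun t => u t.castSucc, mul_assoc]

/-- formula (1) in the proof of Proposition 4.2: on products of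
degree-(1,1) words, `λ` acts as conjugation by `P_k = W λ_{(1,1)}(W) ⋯ λ_{(1,1)}^{k-1}(W)`. -/
theorem stmt8 {m n : ℕ} (hm : 1 ≤ m) (hn : 1 ≤ n) (θ : Equiv.Perm (Fin m × Fin n))
    (se : Fin m → A) (sf : Fin n → A)
    (he : ∀ i k, star (se i) * se k = if i = k then (1:A) else 0)
    (hf : ∀ j l, star (sf j) * sf l = if j = l then (1:A) else 0)
    (hcomm : ∀ i j, se i * sf j = sf (θ (i, j)).2 * se (θ (i, j)).1)
    (hde : ∑ i, se i * star (se i) = 1)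
    (hdf : ∑ j, sf j * star (sf j) = 1)
    (lam : A →⋆ₐ[ℂ] A) (U V : A) (hU : U ∈ unitary A) (hV : V ∈ unitary A)
    (hle : ∀ i, lam (se i) = U * se i) (hlf : ∀ j, lam (sf j) = V * sf j)
    (W : A) (hW : W = U * lamE se V)
    (k : ℕ) (hk : 1 ≤ k) (u v : Fin k → Fin m × Fin n) :
    lam ((List.ofFn fun t => se (u t).1 * sf (u t).2).prod *
        star (List.ofFn fun t => se (v t).1 * sf (v t).2).prod) =
      (List.ofFn fun t : Fin k => (lam11 se sf)^[(t : ℕ)] W).prod *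
        ((List.ofFn fun t => se (u t).1 * sf (u t).2).prod *
          star (List.ofFn fun t => se (v t).1 * sf (v t).2).prod) *
        star ((List.ofFn fun t : Fin k => (lam11 se sf)^[(t : ℕ)] W).prod) := by
  have hφ : ∀ (Y : A) (p : Fin m × Fin n),
      lam11 se sf Y * (se p.1 * sf p.2) = se p.1 * sf p.2 * Y :=
    fun Y p => lam11_mul_letter he hf Y p.1 p.2
  have hlam : ∀ p : Fin m × Fin n, lam (se p.1 * sf p.2) = W * (se p.1 * sf p.2) := by
    intro p
    rw [map_mul, hle, hlf, hW, mul_assoc U (lamE se V), ← mul_assoc (lamE se V),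
      lamE_mul_self he]
    simp only [mul_assoc]
  have hword := fun w : Fin k → Fin m × Fin n =>
    map_prod_ofFn_eq_iterate_prod_mul (x := fun p : Fin m × Fin n => se p.1 * sf p.2)
      hφ lam W hlam w
  rw [map_mul, map_star, hword u, hword v, star_mul]
  simp only [mul_assoc]
end
end

section
/- Assume A is generated by the s's and A is simple. Assume there is a family (γ_t)_{t ∈ 𝕋²} of *-automorphisms of A (𝕋² the 2-torus) such that γ_t(s_{e_i}) = t_1 s_{e_i} and γ_t(s_{f_j}) = t_2 s_{f_j} for all t = (t_1,t_2) and all i, j, and that 𝔉 = {X ∈ A : γ_t(X) = X for all t ∈ 𝕋²}. Let λ : A → A be a unital *-homomorphism and U, V ∈ 𝔉 unitaries with λ(s_{e_i}) = U s_{e_i} and λ(s_{f_j}) = V s_{f_j} for all i, j. Then λ is a *-automorphism of A if and only if λ(𝔉) = 𝔉. -/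
open scoped ComplexOrder

noncomputable section

variable {A : Type*} [CStarAlgebra A]

open scoped CStarAlgebra in
/-- Star homomorphisms of C⋆-algebras that agree on a topologically generating set are equal. -/
theorem starAlgHom_ext_of_topologicalClosure_adjoin_eq_top {S : Set A}
    (hS : (StarAlgebra.adjoin ℂ S).topologicalClosure = ⊤) {φ ψ : A →⋆ₐ[ℂ] A}
    (h : Set.EqOn φ ψ S) : φ = ψ := by
  have hcl : IsClosed (StarAlgHom.equalizer φ ψ : Set A) :=
    isClosed_eq (map_continuous φ) (map_continuous ψ)
  have hle : (StarAlgebra.adjoin ℂ S).topologicalClosure ≤ StarAlgHom.equalizer φ ψ :=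
    StarSubalgebra.topologicalClosure_minimal
      (StarAlgebra.adjoin_le fun x hx => h hx) hcl
  ext x
  exact hle (hS ▸ StarSubalgebra.mem_top)

open scoped CStarAlgebra in
/-- A star endomorphism of a C⋆-algebra with no nontrivial closed two-sided ideals is injective. -/
theorem starAlgHom_injective_of_simple
    (hsimple : ∀ I : TwoSidedIdeal A, IsClosed (I : Set A) → I = ⊥ ∨ I = ⊤)
    (φ : A →⋆ₐ[ℂ] A) : Function.Injective φ := by
  have hker : ((TwoSidedIdeal.ker φ : TwoSidedIdeal A) : Set A) = φ ⁻¹' {0} := by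
    ext x
    simp [TwoSidedIdeal.mem_ker]
  have hcl : IsClosed ((TwoSidedIdeal.ker φ : TwoSidedIdeal A) : Set A) :=
    hker ▸ isClosed_singleton.preimage (map_continuous φ)
  rcases hsimple _ hcl with h | h
  · exact (TwoSidedIdeal.ker_eq_bot φ).1 h
  · have h1 : (1 : A) ∈ TwoSidedIdeal.ker φ := h ▸ TwoSidedIdeal.mem_top A
    rw [TwoSidedIdeal.mem_ker, map_one] at h1
    have : Subsingleton A := subsingleton_of_zero_eq_one h1.symm
    exact Function.injective_of_subsingleton φ

/-- Proposition 4.2(ii): for `U, V ∈ 𝔉`, the endomorphism `λ_{(U,V)}`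
is an automorphism iff `λ_{(U,V)}(𝔉) = 𝔉`. -/
theorem stmt10 {m n : ℕ} (hm : 1 ≤ m) (hn : 1 ≤ n) (θ : Equiv.Perm (Fin m × Fin n))
    (se : Fin m → A) (sf : Fin n → A)
    (he : ∀ i k, star (se i) * se k = if i = k then (1:A) else 0)
    (hf : ∀ j l, star (sf j) * sf l = if j = l then (1:A) else 0)
    (hcomm : ∀ i j, se i * sf j = sf (θ (i, j)).2 * se (θ (i, j)).1)
    (hde : ∑ i, se i * star (se i) = 1)
    (hdf : ∑ j, sf j * star (sf j) = 1)
    (hgen : (StarAlgebra.adjoin ℂ (Set.range se ∪ Set.range sf)).topologicalClosure = ⊤)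
    (hsimple : ∀ I : TwoSidedIdeal A, IsClosed (I : Set A) → I = ⊥ ∨ I = ⊤)
    (γ : ℂ → ℂ → (A ≃⋆ₐ[ℂ] A))
    (hγe : ∀ t₁ t₂ : ℂ, ‖t₁‖ = 1 → ‖t₂‖ = 1 → ∀ i, γ t₁ t₂ (se i) = t₁ • se i)
    (hγf : ∀ t₁ t₂ : ℂ, ‖t₁‖ = 1 → ‖t₂‖ = 1 → ∀ j, γ t₁ t₂ (sf j) = t₂ • sf j)
    (hFfix : (FF se sf : Set A) =
      {X : A | ∀ t₁ t₂ : ℂ, ‖t₁‖ = 1 → ‖t₂‖ = 1 → γ t₁ t₂ X = X})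
    (lam : A →⋆ₐ[ℂ] A) (U V : A) (hU : U ∈ unitary A) (hV : V ∈ unitary A)
    (hUF : U ∈ FF se sf) (hVF : V ∈ FF se sf)
    (hle : ∀ i, lam (se i) = U * se i) (hlf : ∀ j, lam (sf j) = V * sf j) :
    Function.Bijective lam ↔ lam '' (FF se sf : Set A) = (FF se sf : Set A) := by
  have mem_iff (X : A) : X ∈ FF se sf ↔
      ∀ t₁ t₂ : ℂ, ‖t₁‖ = 1 → ‖t₂‖ = 1 → γ t₁ t₂ X = X := by
    rw [← SetLike.mem_coe, hFfix, Set.mem_ofPred_eq]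
  have equivariant (t₁ t₂ : ℂ) (h₁ : ‖t₁‖ = 1) (h₂ : ‖t₂‖ = 1) (X : A) :
      γ t₁ t₂ (lam X) = lam (γ t₁ t₂ X) := by
    have key : ((γ t₁ t₂ : A →⋆ₐ[ℂ] A)).comp lam = lam.comp (γ t₁ t₂ : A →⋆ₐ[ℂ] A) := by
      refine starAlgHom_ext_of_topologicalClosure_adjoin_eq_top hgen ?_
      rintro _ (⟨i, rfl⟩ | ⟨j, rfl⟩)
      · simp [hle, hγe t₁ t₂ h₁ h₂, (mem_iff U).1 hUF t₁ t₂ h₁ h₂]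
      · simp [hlf, hγf t₁ t₂ h₁ h₂, (mem_iff V).1 hVF t₁ t₂ h₁ h₂]
    exact DFunLike.congr_fun key X
  have star_mem {X : A} (hX : X ∈ FF se sf) : star X ∈ FF se sf := by
    rw [mem_iff] at hX ⊢
    intro t₁ t₂ h₁ h₂
    rw [map_star, hX t₁ t₂ h₁ h₂]
  constructor
  · rintro ⟨hinj, hsurj⟩
    apply Set.Subset.antisymm
    · rintro _ ⟨X, hX, rfl⟩
      refine (mem_iff _).2 fun t₁ t₂ h₁ h₂ => ?_
      rw [equivariant t₁ t₂ h₁ h₂, (mem_iff X).1 hX t₁ t₂ h₁ h₂]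
    · intro Y hY
      obtain ⟨X, rfl⟩ := hsurj Y
      refine ⟨X, (mem_iff X).2 fun t₁ t₂ h₁ h₂ => hinj ?_, rfl⟩
      rw [← equivariant t₁ t₂ h₁ h₂, (mem_iff _).1 hY t₁ t₂ h₁ h₂]
  · intro himage
    have hinj := starAlgHom_injective_of_simple hsimple lam
    have mem_range {X : A} (hX : X ∈ FF se sf) : X ∈ lam.range := by
      obtain ⟨Y, -, hY⟩ := himage.symm.subset hX
      exact ⟨Y, hY⟩
    have hcl : IsClosed (lam.range : Set A) := by
      exact (NonUnitalStarAlgHom.isometry lam hinj).isClosedEmbedding.isClosed_range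
    have hgens : Set.range se ∪ Set.range sf ⊆ (lam.range : Set A) := by
      rintro _ (⟨i, rfl⟩ | ⟨j, rfl⟩)
      · have := mul_mem (mem_range (star_mem hUF)) (⟨se i, hle i⟩ : U * se i ∈ lam.range)
        rwa [← mul_assoc, Unitary.star_mul_self_of_mem hU, one_mul] at this
      · have := mul_mem (mem_range (star_mem hVF)) (⟨sf j, hlf j⟩ : V * sf j ∈ lam.range)
        rwa [← mul_assoc, Unitary.star_mul_self_of_mem hV, one_mul] at this
    refine ⟨hinj, fun X => ?_⟩
    exact StarSubalgebra.topologicalClosure_minimal (StarAlgebra.adjoin_le hgens) hcl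
        (hgen ▸ StarSubalgebra.mem_top : X ∈ _)
end
end

section
/- Assume A is generated by the s's and 𝔇 is a masa in A, i.e. {X ∈ A : XD = DX for all D ∈ 𝔇} = 𝔇. Let λ : A → A be a unital *-homomorphism and U, V unitaries of A with λ(s_{e_i}) = U s_{e_i} and λ(s_{f_j}) = V s_{f_j} for all i, j. Then λ(X) = X for all X ∈ 𝔇 if and only if U ∈ 𝔇 and V ∈ 𝔇. -/
open scoped ComplexOrder

noncomputable section

variable {A : Type*} [CStarAlgebra A]

variable {m n : ℕ} {se : Fin m → A} {sf : Fin n → A}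

/-- The range projection of a word, given by lists of letters, lies in `𝔇`. -/
theorem wordProj_mem_DD (a : List (Fin m)) (b : List (Fin n)) :
    ((a.map se).prod * (b.map sf).prod) * star ((a.map se).prod * (b.map sf).prod) ∈
      DD se sf := by
  refine Submodule.le_topologicalClosure _ (Submodule.subset_span
    ⟨a.length, b.length, a.get, b.get, ?_⟩)
  have h₁ : (List.ofFn fun t => se (a.get t)) = a.map se := by
    rw [← Function.comp_def, ← List.map_ofFn, List.ofFn_get]
  have h₂ : (List.ofFn fun t => sf (b.get t)) = b.map sf := by
    rw [← Function.comp_def, ← List.map_ofFn, List.ofFn_get]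
  rw [sWord, h₁, h₂]

/-- A closed subspace containing the range projections of all words contains `𝔇`. -/
theorem DD_le {S : Submodule ℂ A} (hS : IsClosed (S : Set A))
    (h : ∀ (a : List (Fin m)) (b : List (Fin n)),
      ((a.map se).prod * (b.map sf).prod) * star ((a.map se).prod * (b.map sf).prod) ∈ S) :
    DD se sf ≤ S := by
  refine Submodule.topologicalClosure_minimal _ (Submodule.span_le.2 ?_) hS
  rintro x ⟨k, l, a, b, rfl⟩
  have := h (List.ofFn a) (List.ofFn b)
  rwa [List.map_ofFn, List.map_ofFn] at this

/-- An element commuting with the range projections of all words commutes with `𝔇`. -/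
theorem commute_DD {U : A} (h : ∀ (a : List (Fin m)) (b : List (Fin n)),
      Commute U (((a.map se).prod * (b.map sf).prod) *
        star ((a.map se).prod * (b.map sf).prod))) :
    ∀ d ∈ DD se sf, U * d = d * U := by
  let S : Submodule ℂ A := LinearMap.eqLocus (LinearMap.mulLeft ℂ U) (LinearMap.mulRight ℂ U)
  have hS : IsClosed (S : Set A) :=
    isClosed_eq (continuous_const.mul continuous_id) (continuous_id.mul continuous_const)
  exact fun d hd => DD_le (S := S) hS (fun a b => h a b) hd

/-- A letter can be moved from the right end of a word to the left end,
whenever it can be moved across single letters. -/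
theorem exists_prod_mul_eq {ι κ : Type*} {s : ι → A} {t : κ → A}
    (h : ∀ i j, ∃ j' i', s i * t j = t j' * s i') (a : List ι) (j : κ) :
    ∃ (j' : κ) (a' : List ι), (a.map s).prod * t j = t j' * (a'.map s).prod := by
  induction a with
  | nil => exact ⟨j, [], by simp⟩
  | cons i a ih =>
    obtain ⟨j₁, a₁, h₁⟩ := ih
    obtain ⟨j₂, i₂, h₂⟩ := h i j₁
    refine ⟨j₂, i₂ :: a₁, ?_⟩
    simp only [List.map_cons, List.prod_cons]
    rw [mul_assoc, h₁, ← mul_assoc, h₂, mul_assoc]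

/-- If `lam s = U * s` and `lam` fixes both `X` and `s * X * s^*`, then `U` commutes with
`s * X * s^*`. -/
theorem commute_conj_of_fixed {lam : A →⋆ₐ[ℂ] A} {U s X : A} (hU : U ∈ unitary A)
    (hs : lam s = U * s) (hX : lam X = X) (hfix : lam (s * X * star s) = s * X * star s) :
    Commute U (s * X * star s) := by
  have h : U * (s * X * star s) * star U = s * X * star s := by
    rw [map_mul, map_mul, map_star, hs, hX, star_mul] at hfix
    simpa only [mul_assoc] using hfix
  calc U * (s * X * star s) = U * (s * X * star s) * (star U * U) := by
        rw [Unitary.star_mul_self_of_mem hU, mul_one]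
    _ = s * X * star s * U := by rw [← mul_assoc, h]

/-- If `lam s = U * s`, `lam` fixes `X`, and `U` commutes with `s * X * s^*`, then `lam` fixes
`s * X * s^*`. -/
theorem map_conj_of_commute {lam : A →⋆ₐ[ℂ] A} {U s X : A} (hU : U ∈ unitary A)
    (hs : lam s = U * s) (hX : lam X = X) (hc : U * (s * X * star s) = s * X * star s * U) :
    lam (s * X * star s) = s * X * star s := by
  calc lam (s * X * star s) = U * (s * X * star s) * star U := by
        rw [map_mul, map_mul, map_star, hs, hX, star_mul]
        simp only [mul_assoc]
    _ = s * X * star s := by rw [hc, mul_assoc, Unitary.mul_star_self_of_mem hU, mul_one]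

/-- Proposition 4.3(ii): `λ_{(U,V)}` fixes `𝔇` pointwise iff
`U, V ∈ 𝔇`. -/
theorem stmt12 {m n : ℕ} (hm : 1 ≤ m) (hn : 1 ≤ n) (θ : Equiv.Perm (Fin m × Fin n))
    (se : Fin m → A) (sf : Fin n → A)
    (he : ∀ i k, star (se i) * se k = if i = k then (1:A) else 0)
    (hf : ∀ j l, star (sf j) * sf l = if j = l then (1:A) else 0)
    (hcomm : ∀ i j, se i * sf j = sf (θ (i, j)).2 * se (θ (i, j)).1)
    (hde : ∑ i, se i * star (se i) = 1)
    (hdf : ∑ j, sf j * star (sf j) = 1)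
    (hgen : (StarAlgebra.adjoin ℂ (Set.range se ∪ Set.range sf)).topologicalClosure = ⊤)
    (hmasa : {X : A | ∀ d ∈ DD se sf, X * d = d * X} = (DD se sf : Set A))
    (lam : A →⋆ₐ[ℂ] A) (U V : A) (hU : U ∈ unitary A) (hV : V ∈ unitary A)
    (hle : ∀ i, lam (se i) = U * se i) (hlf : ∀ j, lam (sf j) = V * sf j) :
    (∀ x ∈ DD se sf, lam x = x) ↔ (U ∈ DD se sf ∧ V ∈ DD se sf) := by
  have conj_mul (s w : A) : s * w * star (s * w) = s * (w * star w) * star s := by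
    rw [star_mul]; simp only [mul_assoc]
  have sum_conj {p : ℕ} {s : Fin p → A} (hs : ∑ i, s i * star (s i) = 1) (w : A) :
      w * star w = ∑ i, (w * s i) * star (w * s i) := by
    calc w * star w = w * (∑ i, s i * star (s i)) * star w := by rw [hs, mul_one]
      _ = ∑ i, (w * s i) * star (w * s i) := by
        simp only [Finset.mul_sum, Finset.sum_mul, star_mul, mul_assoc]
  have hDe (a : List (Fin m)) : (a.map se).prod * star (a.map se).prod ∈ DD se sf := by
    simpa using wordProj_mem_DD (se := se) (sf := sf) a []
  have hDf (b : List (Fin n)) : (b.map sf).prod * star (b.map sf).prod ∈ DD se sf := by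
    simpa using wordProj_mem_DD (se := se) (sf := sf) [] b
  constructor
  · intro hfix
    have hef : ∀ i j, ∃ j' i', se i * sf j = sf j' * se i' := fun i j => ⟨_, _, hcomm i j⟩
    have hfe : ∀ j i, ∃ i' j', sf j * se i = se i' * sf j' := fun j i =>
      ⟨(θ.symm (i, j)).1, (θ.symm (i, j)).2, by rw [hcomm, Prod.mk.eta, θ.apply_symm_apply]⟩
    have key {W : A} (hW : W ∈ unitary A) {s w : A} (hs : lam s = W * s)
        (hw : w * star w ∈ DD se sf) (hsw : s * w * star (s * w) ∈ DD se sf) :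
        Commute W (s * w * star (s * w)) := by
      rw [conj_mul] at hsw ⊢
      exact commute_conj_of_fixed hW hs (hfix _ hw) (hfix _ hsw)
    rw [← SetLike.mem_coe, ← SetLike.mem_coe, ← hmasa]
    refine ⟨commute_DD fun a b => ?_, commute_DD fun a b => ?_⟩
    · cases a with
      | nil =>
        simp only [List.map_nil, List.prod_nil, one_mul]
        rw [sum_conj hde]
        refine Commute.sum_right _ _ _ fun i _ => ?_
        obtain ⟨i', b', h⟩ := exists_prod_mul_eq hfe b i
        rw [h]
        refine key hU (hle i') (hDf b') ?_
        simpa using wordProj_mem_DD (se := se) (sf := sf) [i'] b'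
      | cons i a =>
        have h := wordProj_mem_DD (se := se) (sf := sf) (i :: a) b
        simp only [List.map_cons, List.prod_cons, mul_assoc (se i) (a.map se).prod] at h ⊢
        exact key hU (hle i) (wordProj_mem_DD a b) h
    · cases b with
      | nil =>
        simp only [List.map_nil, List.prod_nil, mul_one]
        rw [sum_conj hdf]
        refine Commute.sum_right _ _ _ fun j _ => ?_
        obtain ⟨j', a', h⟩ := exists_prod_mul_eq hef a j
        have hmem := wordProj_mem_DD (se := se) (sf := sf) a [j]
        simp only [List.map_cons, List.map_nil, List.prod_cons, List.prod_nil, mul_one] at hmem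
        rw [h] at hmem ⊢
        exact key hV (hlf j') (hDe a') hmem
      | cons j b =>
        obtain ⟨j', a', h⟩ := exists_prod_mul_eq hef a j
        have hmem := wordProj_mem_DD (se := se) (sf := sf) a (j :: b)
        simp only [List.map_cons, List.prod_cons] at hmem ⊢
        rw [← mul_assoc (a.map se).prod, h, mul_assoc (sf j')] at hmem ⊢
        exact key hV (hlf j') (wordProj_mem_DD a' b) hmem
  · rintro ⟨hUD, hVD⟩
    rw [← SetLike.mem_coe, ← hmasa] at hUD hVD
    have hcont : Continuous lam :=
      NonUnitalStarAlgHom.instContinuousLinearMapClassComplex.map_continuous lam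
    let S : Submodule ℂ A := LinearMap.eqLocus lam.toAlgHom.toLinearMap LinearMap.id
    have hS : IsClosed (S : Set A) := isClosed_eq hcont continuous_id
    refine fun x hx => DD_le (S := S) hS (fun a b => ?_) hx
    change lam _ = _
    induction a with
    | nil =>
      induction b with
      | nil => simp
      | cons j b ih =>
        have hmem := hDf (j :: b)
        simp only [List.map_nil, List.prod_nil, one_mul, List.map_cons, List.prod_cons]
          at ih hmem ⊢
        rw [conj_mul] at hmem ⊢
        exact map_conj_of_commute hV (hlf j) ih (hVD _ hmem)
    | cons i a ih =>
      have hmem := wordProj_mem_DD (se := se) (sf := sf) (i :: a) b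
      simp only [List.map_cons, List.prod_cons, mul_assoc (se i) (a.map se).prod] at hmem ⊢
      rw [conj_mul] at hmem ⊢
      exact map_conj_of_commute hU (hle i) ih (hUD _ hmem)
end
end

section
/- Assume A is generated by the s's, A is simple, and 𝔇 is a masa in A (i.e. {X ∈ A : XD = DX for all D ∈ 𝔇} = 𝔇). Let λ : A → A be a unital *-homomorphism and U, V unitaries with U, V ∈ 𝔇, λ(s_{e_i}) = U s_{e_i} and λ(s_{f_j}) = V s_{f_j} for all i, j. Then λ is a *-automorphism of A if and only if λ(𝔇) = 𝔇. -/
open scoped ComplexOrder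

noncomputable section

variable {A : Type*} [CStarAlgebra A]

/-- A unital *-homomorphism that multiplies `s` by a unitary `W` fixes `s * x * s^*` as soon as it
fixes `x` and `W` commutes with `s * x * s^*`. -/
theorem StarAlgHom.map_conj_eq_self {lam : A →⋆ₐ[ℂ] A} {W s x : A} (hW : W ∈ unitary A)
    (hs : lam s = W * s) (hx : lam x = x) (hc : Commute W (s * x * star s)) :
    lam (s * x * star s) = s * x * star s :=
  calc lam (s * x * star s) = W * (s * x * star s) * star W := by
        simp only [map_mul, map_star, hs, hx, star_mul, mul_assoc]
    _ = s * x * star s := by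
        rw [hc.eq, mul_assoc, Unitary.mul_star_self_of_mem hW, mul_one]

/-- The range projection of a word, given by lists of indices, lies in `𝔇`. -/
theorem prod_mul_star_mem_DD {m n : ℕ} (se : Fin m → A) (sf : Fin n → A)
    (a : List (Fin m)) (b : List (Fin n)) :
    ((a.map se).prod * (b.map sf).prod) * star ((a.map se).prod * (b.map sf).prod) ∈
      DD se sf := by
  refine Submodule.le_topologicalClosure _ (Submodule.subset_span ?_)
  refine ⟨a.length, b.length, a.get, b.get, ?_⟩
  simp only [sWord, List.get_eq_getElem, List.ofFn_getElem_eq_map]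

open scoped CStarAlgebra in
/-- If `U` and `V` lie in the commutative algebra `𝔇`, then `λ_{(U,V)}` fixes `𝔇` pointwise. -/
theorem StarAlgHom.eq_self_of_mem_DD {m n : ℕ} {se : Fin m → A} {sf : Fin n → A}
    (hD : ∀ x ∈ DD se sf, ∀ y ∈ DD se sf, Commute x y)
    {lam : A →⋆ₐ[ℂ] A} {U V : A} (hU : U ∈ unitary A) (hV : V ∈ unitary A)
    (hUD : U ∈ DD se sf) (hVD : V ∈ DD se sf)
    (hle : ∀ i, lam (se i) = U * se i) (hlf : ∀ j, lam (sf j) = V * sf j)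
    {x : A} (hx : x ∈ DD se sf) : lam x = x := by
  have hword (a : List (Fin m)) (b : List (Fin n)) :
      lam (((a.map se).prod * (b.map sf).prod) * star ((a.map se).prod * (b.map sf).prod)) =
        ((a.map se).prod * (b.map sf).prod) * star ((a.map se).prod * (b.map sf).prod) := by
    induction a with
    | nil =>
      induction b with
      | nil => simp
      | cons j b ih =>
        have hc := hD V hVD _ (prod_mul_star_mem_DD se sf [] (j :: b))
        simp only [List.map_nil, List.map_cons, List.prod_nil, List.prod_cons, one_mul] at ih hc ⊢
        have h := StarAlgHom.map_conj_eq_self hV (hlf j) ih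
        simp only [star_mul, mul_assoc] at h hc ⊢
        exact h hc
    | cons i a ih =>
      have hc := hD U hUD _ (prod_mul_star_mem_DD se sf (i :: a) b)
      have h := StarAlgHom.map_conj_eq_self hU (hle i) ih
      simp only [List.map_cons, List.prod_cons, star_mul, mul_assoc] at h hc ⊢
      exact h hc
  have hcont : Continuous lam := map_continuous lam
  have hle' : DD se sf ≤ LinearMap.eqLocus lam.toAlgHom.toLinearMap LinearMap.id := by
    refine Submodule.topologicalClosure_minimal _ (Submodule.span_le.2 ?_)
      (isClosed_eq hcont continuous_id)
    rintro _ ⟨k, l, a, b, rfl⟩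
    have h := hword (List.ofFn a) (List.ofFn b)
    simp only [List.map_ofFn] at h
    exact h
  exact hle' hx

open scoped CStarAlgebra in
/-- A unital *-endomorphism of a topologically simple C*-algebra is injective. -/
theorem StarAlgHom.injective_of_simple
    (hsimple : ∀ I : TwoSidedIdeal A, IsClosed (I : Set A) → I = ⊥ ∨ I = ⊤)
    (lam : A →⋆ₐ[ℂ] A) : Function.Injective lam := by
  have hcont : Continuous lam := map_continuous lam
  have hclosed : IsClosed (TwoSidedIdeal.ker lam : Set A) := by
    have : (TwoSidedIdeal.ker lam : Set A) = lam ⁻¹' {0} := by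
      ext x
      simp [TwoSidedIdeal.mem_ker]
    rw [this]
    exact isClosed_singleton.preimage hcont
  rcases hsimple _ hclosed with h | h
  · exact (TwoSidedIdeal.ker_eq_bot lam).1 h
  · have h1 : (1 : A) ∈ TwoSidedIdeal.ker lam := h ▸ trivial
    rw [TwoSidedIdeal.mem_ker, map_one] at h1
    have := subsingleton_of_zero_eq_one h1.symm
    exact Function.injective_of_subsingleton _

/-- An injective *-endomorphism of a C*-algebra whose range contains a generating set is onto. -/
theorem StarAlgHom.surjective_of_subset_range {lam : A →⋆ₐ[ℂ] A} (hinj : Function.Injective lam)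
    {S : Set A} (hS : (StarAlgebra.adjoin ℂ S).topologicalClosure = ⊤)
    (hrange : S ⊆ Set.range lam) : Function.Surjective lam := by
  have hclosed : IsClosed (lam.range : Set A) := by
    exact (NonUnitalStarAlgHom.isometry lam hinj).isClosedEmbedding.isClosed_range
  have hle : (StarAlgebra.adjoin ℂ S).topologicalClosure ≤ lam.range :=
    StarSubalgebra.topologicalClosure_minimal
      (StarAlgebra.adjoin_le fun x hx => hrange hx) hclosed
  intro x
  exact hle (hS ▸ trivial : x ∈ (StarAlgebra.adjoin ℂ S).topologicalClosure)

/-- Proposition 4.3(iv): for `U, V ∈ 𝔇`, the endomorphism `λ_{(U,V)}`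
is an automorphism iff `λ_{(U,V)}(𝔇) = 𝔇`. -/
theorem stmt14 {m n : ℕ} (hm : 1 ≤ m) (hn : 1 ≤ n) (θ : Equiv.Perm (Fin m × Fin n))
    (se : Fin m → A) (sf : Fin n → A)
    (he : ∀ i k, star (se i) * se k = if i = k then (1:A) else 0)
    (hf : ∀ j l, star (sf j) * sf l = if j = l then (1:A) else 0)
    (hcomm : ∀ i j, se i * sf j = sf (θ (i, j)).2 * se (θ (i, j)).1)
    (hde : ∑ i, se i * star (se i) = 1)
    (hdf : ∑ j, sf j * star (sf j) = 1)
    (hgen : (StarAlgebra.adjoin ℂ (Set.range se ∪ Set.range sf)).topologicalClosure = ⊤)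
    (hsimple : ∀ I : TwoSidedIdeal A, IsClosed (I : Set A) → I = ⊥ ∨ I = ⊤)
    (hmasa : {X : A | ∀ d ∈ DD se sf, X * d = d * X} = (DD se sf : Set A))
    (lam : A →⋆ₐ[ℂ] A) (U V : A) (hU : U ∈ unitary A) (hV : V ∈ unitary A)
    (hUD : U ∈ DD se sf) (hVD : V ∈ DD se sf)
    (hle : ∀ i, lam (se i) = U * se i) (hlf : ∀ j, lam (sf j) = V * sf j) :
    Function.Bijective lam ↔ lam '' (DD se sf : Set A) = (DD se sf : Set A) := by
  have hD : ∀ x ∈ DD se sf, ∀ y ∈ DD se sf, Commute x y := fun x hx => by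
    have hx' : x ∈ {X : A | ∀ d ∈ DD se sf, X * d = d * X} := hmasa ▸ hx
    exact hx'
  have hfix : ∀ x ∈ DD se sf, lam x = x := fun x hx =>
    StarAlgHom.eq_self_of_mem_DD hD hU hV hUD hVD hle hlf hx
  have hinj := StarAlgHom.injective_of_simple hsimple lam
  have hbij : Function.Bijective lam := by
    refine ⟨hinj, StarAlgHom.surjective_of_subset_range hinj hgen ?_⟩
    rintro _ (⟨i, rfl⟩ | ⟨j, rfl⟩)
    · refine ⟨star U * se i, ?_⟩
      rw [map_mul, map_star, hfix U hUD, hle, ← mul_assoc, Unitary.star_mul_self_of_mem hU,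
        one_mul]
    · refine ⟨star V * sf j, ?_⟩
      rw [map_mul, map_star, hfix V hVD, hlf, ← mul_assoc, Unitary.star_mul_self_of_mem hV,
        one_mul]
  have himage : lam '' (DD se sf : Set A) = (DD se sf : Set A) :=
    (Set.image_congr hfix).trans (Set.image_id' _)
  exact iff_of_true hbij himage
end
end

section
/- Let φ be a state on A whose restriction to 𝔉 is tracial, i.e. φ(XY) = φ(YX) for all X, Y ∈ 𝔉. Then for all k, l ∈ ℕ, all a, a' ∈ {1,…,m}^k, all b, b' ∈ {1,…,n}^l, and all X ∈ 𝔉: φ(s_{a,b} X s_{a',b'}^*) = δ_{a,a'} δ_{b,b'} m^{-k} n^{-l} φ(X). In particular, φ(s_{a,b} s_{a',b'}^*) = δ_{a,a'} δ_{b,b'} m^{-k} n^{-l}. -/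
open scoped ComplexOrder

noncomputable section

variable {A : Type*} [CStarAlgebra A]

open scoped Pointwise in
/-- If every product `s * t` rewrites as `t' * s'`, bijectively in the indices, then the sets of
products of generators commute. -/
theorem commute_range_of_perm {m n : ℕ} (θ : Equiv.Perm (Fin m × Fin n))
    {se : Fin m → A} {sf : Fin n → A}
    (hcomm : ∀ i j, se i * sf j = sf (θ (i, j)).2 * se (θ (i, j)).1) :
    Commute (Set.range se) (Set.range sf) := by
  refine Set.Subset.antisymm ?_ ?_
  · rintro _ ⟨_, ⟨i, rfl⟩, _, ⟨j, rfl⟩, rfl⟩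
    exact ⟨_, ⟨_, rfl⟩, _, ⟨_, rfl⟩, (hcomm i j).symm⟩
  · rintro _ ⟨_, ⟨j, rfl⟩, _, ⟨i, rfl⟩, rfl⟩
    refine ⟨_, ⟨(θ.symm (i, j)).1, rfl⟩, _, ⟨(θ.symm (i, j)).2, rfl⟩, ?_⟩
    simp [hcomm]

open scoped Pointwise in
theorem mem_range_pow_iff {M ι : Type*} [Monoid M] {s : ι → M} {k : ℕ} {x : M} :
    x ∈ Set.range s ^ k ↔ ∃ a : Fin k → ι, (List.ofFn fun t => s (a t)).prod = x := by
  rw [Set.mem_pow]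
  constructor
  · rintro ⟨f, rfl⟩
    choose a ha using fun t => (f t).2
    exact ⟨a, by simp only [ha]⟩
  · rintro ⟨a, rfl⟩
    exact ⟨fun t => ⟨s (a t), a t, rfl⟩, rfl⟩

open scoped Pointwise in
theorem mem_range_pow_mul_range_pow_iff {m n : ℕ} {se : Fin m → A} {sf : Fin n → A} {k l : ℕ}
    {x : A} : x ∈ Set.range se ^ k * Set.range sf ^ l ↔
      ∃ (a : Fin k → Fin m) (b : Fin l → Fin n), sWord se sf a b = x := by
  simp only [Set.mem_mul, mem_range_pow_iff, sWord]
  constructor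
  · rintro ⟨_, ⟨a, rfl⟩, _, ⟨b, rfl⟩, rfl⟩
    exact ⟨a, b, rfl⟩
  · rintro ⟨a, b, rfl⟩
    exact ⟨_, ⟨a, rfl⟩, _, ⟨b, rfl⟩, rfl⟩

open scoped Pointwise in
theorem exists_sWord_eq_mul {m n : ℕ} (θ : Equiv.Perm (Fin m × Fin n))
    {se : Fin m → A} {sf : Fin n → A}
    (hcomm : ∀ i j, se i * sf j = sf (θ (i, j)).2 * se (θ (i, j)).1)
    {k l p q : ℕ} (a : Fin k → Fin m) (b : Fin l → Fin n) (u : Fin p → Fin m)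
    (v : Fin q → Fin n) :
    ∃ (x : Fin (k + p) → Fin m) (y : Fin (l + q) → Fin n),
      sWord se sf x y = sWord se sf a b * sWord se sf u v := by
  rw [← mem_range_pow_mul_range_pow_iff, pow_add, pow_add, mul_assoc,
    ← mul_assoc (Set.range se ^ p), ((commute_range_of_perm θ hcomm).pow_pow p l).eq,
    mul_assoc, ← mul_assoc]
  exact Set.mul_mem_mul (mem_range_pow_mul_range_pow_iff.2 ⟨a, b, rfl⟩)
    (mem_range_pow_mul_range_pow_iff.2 ⟨u, v, rfl⟩)

theorem star_prod_ofFn_mul_prod_ofFn {m : ℕ} {s : Fin m → A}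
    (hs : ∀ i j, star (s i) * s j = if i = j then (1 : A) else 0) {k : ℕ} (a a' : Fin k → Fin m) :
    star (List.ofFn fun t => s (a t)).prod * (List.ofFn fun t => s (a' t)).prod =
      if a = a' then 1 else 0 := by
  induction k with
  | zero => simp [Subsingleton.elim a a']
  | succ k ih =>
    rw [List.ofFn_succ, List.ofFn_succ, List.prod_cons, List.prod_cons, star_mul, mul_assoc,
      ← mul_assoc (star (s (a 0))), hs]
    have h : a = a' ↔ a 0 = a' 0 ∧ (fun t : Fin k => a t.succ) = fun t => a' t.succ := by
      simp [funext_iff, Fin.forall_fin_succ]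
    by_cases h0 : a 0 = a' 0
    · simp [h0, ih, h]
    · simp [h0, h]

theorem sum_prod_ofFn_mul_star {m : ℕ} {s : Fin m → A} (hs : ∑ i, s i * star (s i) = 1) (k : ℕ) :
    ∑ a : Fin k → Fin m,
      (List.ofFn fun t => s (a t)).prod * star (List.ofFn fun t => s (a t)).prod = 1 := by
  induction k with
  | zero => simp
  | succ k ih =>
    rw [← (Fin.consEquiv fun _ => Fin m).sum_comp, Fintype.sum_prod_type, ← hs]
    refine Finset.sum_congr rfl fun i _ => ?_
    simp only [Fin.consEquiv, Equiv.coe_fn_mk, List.ofFn_succ, Fin.cons_zero, Fin.cons_succ,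
      List.prod_cons, star_mul]
    calc _ = s i * (∑ a : Fin k → Fin m, (List.ofFn fun t => s (a t)).prod *
          star (List.ofFn fun t => s (a t)).prod) * star (s i) := by
            simp only [Finset.mul_sum, Finset.sum_mul, mul_assoc]
      _ = _ := by rw [ih, mul_one]

theorem star_sWord_mul_sWord {m n : ℕ} {se : Fin m → A} {sf : Fin n → A}
    (he : ∀ i k, star (se i) * se k = if i = k then (1 : A) else 0)
    (hf : ∀ j l, star (sf j) * sf l = if j = l then (1 : A) else 0)
    {k l : ℕ} (a a' : Fin k → Fin m) (b b' : Fin l → Fin n) :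
    star (sWord se sf a b) * sWord se sf a' b' =
      (if a = a' then 1 else 0) * (if b = b' then 1 else 0) := by
  rw [sWord, sWord, star_mul, mul_assoc, ← mul_assoc (star (List.ofFn fun t => se (a t)).prod),
    star_prod_ofFn_mul_prod_ofFn he]
  split_ifs <;> simp_all [star_prod_ofFn_mul_prod_ofFn hf]

theorem sum_sWord_mul_star {m n : ℕ} {se : Fin m → A} {sf : Fin n → A}
    (hde : ∑ i, se i * star (se i) = 1) (hdf : ∑ j, sf j * star (sf j) = 1) (k l : ℕ) :
    ∑ a : Fin k → Fin m, ∑ b : Fin l → Fin n, sWord se sf a b * star (sWord se sf a b) = 1 := by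
  rw [← sum_prod_ofFn_mul_star hde k]
  refine Finset.sum_congr rfl fun a _ => ?_
  calc _ = (List.ofFn fun t => se (a t)).prod * (∑ b : Fin l → Fin n,
        (List.ofFn fun t => sf (b t)).prod * star (List.ofFn fun t => sf (b t)).prod) *
          star (List.ofFn fun t => se (a t)).prod := by
          simp only [sWord, star_mul, Finset.mul_sum, Finset.sum_mul, mul_assoc]
    _ = _ := by rw [sum_prod_ofFn_mul_star hdf, mul_one]

theorem sWord_mul_star_mem_FF {m n : ℕ} (se : Fin m → A) (sf : Fin n → A) {k l : ℕ}
    (a a' : Fin k → Fin m) (b b' : Fin l → Fin n) :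
    sWord se sf a b * star (sWord se sf a' b') ∈ FF se sf :=
  Submodule.le_topologicalClosure _ (Submodule.subset_span ⟨k, l, a, a', b, b', rfl⟩)

/-- Positive linear functionals on a C⋆-algebra are continuous. -/
theorem continuous_of_map_star_mul_self_nonneg (φ : A →ₗ[ℂ] ℂ)
    (hpos : ∀ a : A, 0 ≤ φ (star a * a)) : Continuous φ := by
  let _ := CStarAlgebra.spectralOrder A
  let _ := CStarAlgebra.spectralOrderedRing A
  have h : ∀ x : A, 0 ≤ x → 0 ≤ φ x := fun x hx => by
    obtain ⟨y, rfl⟩ := CStarAlgebra.nonneg_iff_eq_star_mul_self.1 hx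
    exact hpos y
  exact map_continuous (PositiveLinearMap.mk₀ φ h)

/-- A functional tracial on `𝔉` takes the value `m^{-k} n^{-l} δ` on matrix units. -/
theorem map_sWord_mul_star_sWord {m n : ℕ} (hm : 1 ≤ m) (hn : 1 ≤ n)
    {se : Fin m → A} {sf : Fin n → A}
    (he : ∀ i k, star (se i) * se k = if i = k then (1 : A) else 0)
    (hf : ∀ j l, star (sf j) * sf l = if j = l then (1 : A) else 0)
    (hde : ∑ i, se i * star (se i) = 1) (hdf : ∑ j, sf j * star (sf j) = 1)
    {φ : A →ₗ[ℂ] ℂ} (hone : φ 1 = 1)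
    (htrace : ∀ X ∈ FF se sf, ∀ Y ∈ FF se sf, φ (X * Y) = φ (Y * X))
    {k l : ℕ} (a a' : Fin k → Fin m) (b b' : Fin l → Fin n) :
    φ (sWord se sf a b * star (sWord se sf a' b')) =
      ((m : ℂ) ^ k)⁻¹ * ((n : ℂ) ^ l)⁻¹ * φ (star (sWord se sf a b) * sWord se sf a' b') := by
  have hm0 : (m : ℂ) ≠ 0 := by exact_mod_cast Nat.one_le_iff_ne_zero.1 hm
  have hn0 : (n : ℂ) ≠ 0 := by exact_mod_cast Nat.one_le_iff_ne_zero.1 hn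
  have hort := @star_sWord_mul_sWord A _ m n se sf he hf k l
  have hiso : ∀ a b, star (sWord se sf (k := k) (l := l) a b) * sWord se sf a b = 1 :=
    fun a b => by simp [hort]
  by_cases h : a = a' ∧ b = b'
  · obtain ⟨rfl, rfl⟩ := h
    have hconst : ∀ (c : Fin k → Fin m) (d : Fin l → Fin n),
        φ (sWord se sf c d * star (sWord se sf c d)) =
          φ (sWord se sf a b * star (sWord se sf a b)) := fun c d => by
      have := htrace _ (sWord_mul_star_mem_FF se sf c a d b) _
        (sWord_mul_star_mem_FF se sf a c b d)
      rwa [mul_assoc, ← mul_assoc _ (sWord se sf a b), hiso, one_mul,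
        mul_assoc, ← mul_assoc _ (sWord se sf c d), hiso, one_mul] at this
    have hsum := congrArg φ (sum_sWord_mul_star hde hdf k l)
    simp only [map_sum, hconst, hone, Finset.sum_const, Finset.card_univ, Fintype.card_fun,
      Fintype.card_fin, nsmul_eq_mul, Nat.cast_pow] at hsum
    rw [hiso, hone, mul_one]
    field_simp
    linear_combination hsum
  · have h0 : star (sWord se sf a b) * sWord se sf a' b' = 0 := by
      rw [hort]
      split_ifs <;> simp_all
    have h0' : star (sWord se sf a' b') * sWord se sf a b = 0 := by
      simpa using congrArg star h0
    have := htrace _ (sWord_mul_star_mem_FF se sf a a b b) _ (sWord_mul_star_mem_FF se sf a a' b b')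
    rw [mul_assoc, ← mul_assoc _ (sWord se sf a b), hiso, one_mul,
      mul_assoc, ← mul_assoc _ (sWord se sf a b), h0', zero_mul, mul_zero, map_zero] at this
    rw [this, h0, map_zero, mul_zero]

/-- Lemma 5.1: for a state `φ` that is tracial on `𝔉`,
`φ(s_{a,b} X s_{a',b'}^*) = δ_{a,a'} δ_{b,b'} m^{-k} n^{-l} φ(X)` for all `X ∈ 𝔉`, and in
particular `φ(s_{a,b} s_{a',b'}^*) = δ_{a,a'} δ_{b,b'} m^{-k} n^{-l}`. -/
theorem stmt16 {m n : ℕ} (hm : 1 ≤ m) (hn : 1 ≤ n) (θ : Equiv.Perm (Fin m × Fin n))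
    (se : Fin m → A) (sf : Fin n → A)
    (he : ∀ i k, star (se i) * se k = if i = k then (1:A) else 0)
    (hf : ∀ j l, star (sf j) * sf l = if j = l then (1:A) else 0)
    (hcomm : ∀ i j, se i * sf j = sf (θ (i, j)).2 * se (θ (i, j)).1)
    (hde : ∑ i, se i * star (se i) = 1)
    (hdf : ∑ j, sf j * star (sf j) = 1)
    (φ : A →ₗ[ℂ] ℂ) (hpos : ∀ a : A, 0 ≤ φ (star a * a)) (hone : φ 1 = 1)
    (htrace : ∀ X ∈ FF se sf, ∀ Y ∈ FF se sf, φ (X * Y) = φ (Y * X)) :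
    ∀ (k l : ℕ) (a a' : Fin k → Fin m) (b b' : Fin l → Fin n),
      (∀ X ∈ FF se sf,
        φ (sWord se sf a b * X * star (sWord se sf a' b')) =
          (if a = a' then 1 else 0) * (if b = b' then 1 else 0) *
            ((m : ℂ) ^ k)⁻¹ * ((n : ℂ) ^ l)⁻¹ * φ X) ∧
      φ (sWord se sf a b * star (sWord se sf a' b')) =
        (if a = a' then 1 else 0) * (if b = b' then 1 else 0) *
          ((m : ℂ) ^ k)⁻¹ * ((n : ℂ) ^ l)⁻¹ := by
  intro k l a a' b b'
  have hmap := @map_sWord_mul_star_sWord A _ m n hm hn se sf he hf hde hdf φ hone htrace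
  have hφ : Continuous φ := continuous_of_map_star_mul_self_nonneg φ hpos
  have hunit : φ (star (sWord se sf a b) * sWord se sf a' b') =
      (if a = a' then 1 else 0) * (if b = b' then 1 else 0) := by
    rw [star_sWord_mul_sWord he hf]
    split_ifs <;> simp [hone]
  refine ⟨fun X hX => ?_, by rw [hmap, hunit]; ring⟩
  refine Set.EqOn.closure (s := (Submodule.span ℂ _ : Submodule ℂ A))
    (f := fun X => φ (sWord se sf a b * X * star (sWord se sf a' b')))
    (g := fun X => (if a = a' then 1 else 0) * (if b = b' then 1 else 0) *
      ((m : ℂ) ^ k)⁻¹ * ((n : ℂ) ^ l)⁻¹ * φ X)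
    (fun Y hY => ?_) (by fun_prop) (by fun_prop) hX
  refine LinearMap.eqOn_span (f := φ ∘ₗ LinearMap.mulRight ℂ (star (sWord se sf a' b')) ∘ₗ
    LinearMap.mulLeft ℂ (sWord se sf a b)) (g := ((if a = a' then 1 else 0) *
      (if b = b' then 1 else 0) * ((m : ℂ) ^ k)⁻¹ * ((n : ℂ) ^ l)⁻¹) • φ) ?_ hY
  rintro _ ⟨p, q, u, u', v, v', rfl⟩
  simp only [LinearMap.comp_apply, LinearMap.mulLeft_apply, LinearMap.mulRight_apply,
    LinearMap.smul_apply, smul_eq_mul]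
  obtain ⟨x, y, hxy⟩ := exists_sWord_eq_mul θ hcomm a b u v
  obtain ⟨x', y', hxy'⟩ := exists_sWord_eq_mul θ hcomm a' b' u' v'
  have hleft : sWord se sf a b * (sWord se sf u v * star (sWord se sf u' v')) *
      star (sWord se sf a' b') = sWord se sf x y * star (sWord se sf x' y') := by
    rw [hxy, hxy', star_mul]
    simp only [mul_assoc]
  have hinner : star (sWord se sf x y) * sWord se sf x' y' =
      star (sWord se sf u v) * (star (sWord se sf a b) * sWord se sf a' b') *
        sWord se sf u' v' := by
    rw [hxy, hxy', star_mul]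
    simp only [mul_assoc]
  rw [hleft, hmap, hmap, hinner, star_sWord_mul_sWord he hf a a']
  split_ifs <;> simp [pow_add]
  ring
end
end

section
/- Let m = n, let θ be the flip permutation θ(i,j) = (j,i) (so the relations read s_{e_i} s_{f_j} = s_{f_i} s_{e_j} for all i, j), assume A is generated by the s's, and assume there exist indices i, j with s_{e_i} s_{e_j} ≠ s_{f_i} s_{f_j}. Then there is no unitary W ∈ A such that W s_{e_i} W^* = s_{f_i} and W s_{f_i} W^* = s_{e_i} for all i = 1,…,m; that is, the automorphism of A exchanging the two families of generators (when it exists) is outer. -/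
open scoped ComplexOrder

noncomputable section

variable {A : Type*} [CStarAlgebra A]

theorem commute_star_of_sum_mul_star_eq_one {m : ℕ} (s : Fin m → A)
    (h : ∀ i k, star (s i) * s k = if i = k then (1 : A) else 0)
    (hd : ∑ i, s i * star (s i) = 1) {u : A} (hu : ∀ i, u * s i = s i * u) (i : Fin m) :
    u * star (s i) = star (s i) * u := by
  calc u * star (s i) = ∑ k, (star (s i) * s k) * u * star (s k) := by simp [h]
    _ = ∑ k, star (s i) * u * (s k * star (s k)) :=
        Finset.sum_congr rfl fun k _ => by
          rw [mul_assoc (star (s i)), ← hu k]; simp only [mul_assoc]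
    _ = star (s i) * u := by rw [← Finset.mul_sum, hd, mul_one]

theorem eq_of_mul_eq_of_sum_mul_star_eq_one {m : ℕ} (s : Fin m → A)
    (hd : ∑ i, s i * star (s i) = 1) {u v : A} (h : ∀ i, u * s i = v * s i) : u = v := by
  rw [← mul_one u, ← mul_one v, ← hd, Finset.mul_sum, Finset.mul_sum]
  exact Finset.sum_congr rfl fun i _ => by rw [← mul_assoc, h, mul_assoc]

theorem commute_of_adjoin_topologicalClosure_eq_top {S : Set A} {u : A}
    (hS : (StarAlgebra.adjoin ℂ S).topologicalClosure = ⊤)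
    (h : ∀ x ∈ S, u * x = x * u) (hstar : ∀ x ∈ S, u * star x = star x * u) (x : A) :
    u * x = x * u := by
  have key : ∀ y ∈ StarAlgebra.adjoin ℂ S, u * y = y * u ∧ u * star y = star y * u := by
    intro y hy
    induction hy using StarAlgebra.adjoin_induction with
    | mem y hy => exact ⟨h y hy, hstar y hy⟩
    | algebraMap r =>
      rw [← algebraMap_star_comm]
      exact ⟨(Algebra.commutes _ _).symm, (Algebra.commutes _ _).symm⟩
    | add y z _ _ hy hz =>
      simp only [star_add, mul_add, add_mul, hy, hz, and_self]
    | mul y z _ _ hy hz =>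
      rw [star_mul]
      exact ⟨Commute.mul_right hy.1 hz.1, Commute.mul_right hz.2 hy.2⟩
    | star y _ hy => exact ⟨hy.2, by rw [star_star]; exact hy.1⟩
  have hx : x ∈ (StarAlgebra.adjoin ℂ S).topologicalClosure := hS ▸ StarSubalgebra.mem_top
  have hc : IsClosed {y : A | u * y = y * u} := isClosed_eq (by fun_prop) (by fun_prop)
  exact closure_minimal (fun y hy => (key y hy).1) hc hx

/-- outerness assertion of Example 3.12: for the flip relation with
`s_{e_i}s_{e_j} ≠ s_{f_i}s_{f_j}` for some `i, j`, no unitary `W` conjugates the `s_{e_i}`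
to the `s_{f_i}` and vice versa: the exchange automorphism is outer. -/
theorem stmt18 {m : ℕ} (hm : 1 ≤ m) (se sf : Fin m → A)
    (he : ∀ i k, star (se i) * se k = if i = k then (1:A) else 0)
    (hf : ∀ j l, star (sf j) * sf l = if j = l then (1:A) else 0)
    (hcomm : ∀ i j, se i * sf j = sf i * se j)
    (hde : ∑ i, se i * star (se i) = 1)
    (hdf : ∑ j, sf j * star (sf j) = 1)
    (hgen : (StarAlgebra.adjoin ℂ (Set.range se ∪ Set.range sf)).topologicalClosure = ⊤)
    (i j : Fin m) (hne : se i * se j ≠ sf i * sf j) :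
    ¬ ∃ W ∈ unitary A, (∀ i, W * se i * star W = sf i) ∧ (∀ i, W * sf i * star W = se i) := by
  rintro ⟨W, hW, hWe, hWf⟩
  obtain ⟨u, hu⟩ : ∃ u : A, ∀ i, u * se i = sf i :=
    ⟨∑ k, sf k * star (se k), fun i => by simp [Finset.sum_mul, mul_assoc, he]⟩
  have hue : ∀ i, u * se i = se i * u := fun i =>
    eq_of_mul_eq_of_sum_mul_star_eq_one se hde fun k => by
      rw [hu, ← hcomm, mul_assoc, hu]
  have huf : ∀ i, u * sf i = sf i * u := fun i => by
    rw [← hu, mul_assoc, hue]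
  have huW : u * W = W * u := by
    refine commute_of_adjoin_topologicalClosure_eq_top hgen ?_ ?_ W
    · rintro _ (⟨k, rfl⟩ | ⟨k, rfl⟩)
      exacts [hue k, huf k]
    · rintro _ (⟨k, rfl⟩ | ⟨k, rfl⟩)
      exacts [commute_star_of_sum_mul_star_eq_one se he hde hue k,
        commute_star_of_sum_mul_star_eq_one sf hf hdf huf k]
  have huu : ∀ k, u * sf k = se k := fun k => by
    rw [← hWf k, ← hu k, ← mul_assoc W, ← huW, mul_assoc u, mul_assoc u, hWe, hu]
  apply hne
  rw [← huu i, huf, mul_assoc, hu]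
end
end
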